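/- (Gated-FFN expected projected output energy.) Let W_g ∈ ℝ^{r×d}, W_u ∈ ℝ^{r×d}, and W̃_o ∈ ℝ^{d_out×r} be independent random matrices whose entries are independent centered Gaussians with variances σ², σ², and τ_g² > 0 respectively, let P ∈ ℝ^{d_out×d_out} be an orthogonal projector of rank r_P, let x ∈ ℝ^d be fixed with ν = σ²‖x‖₂², and let ψ : ℝ → ℝ be measurable with E[ψ(G_ν)²] < ∞ where G_ν ~ N(0, ν). Then E‖P W̃_o (ψ(W_g x) ⊙ (W_u x))‖₂² = r_P · τ_g² · r · ν · E[ψ(G_ν)²], where ψ is applied entrywise and ⊙ denotes the entrywise (Hadamard) product. -/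

import Mathlib

open Matrix MeasureTheory ProbabilityTheory

lemma aux_trace {n : ℕ} (P : Matrix (Fin n) (Fin n) ℝ) (hP2 : P * P = P) :
    P.trace = (P.rank : ℝ) := by
  have h : IsIdempotentElem (Matrix.toLin' P) := by
    unfold IsIdempotentElem
    rw [Module.End.mul_eq_comp, ← Matrix.toLin'_mul, hP2]
  have := (LinearMap.IsIdempotentElem.isProj_range _ h).trace
  rw [Matrix.trace_toLin'_eq] at this
  rw [this]
  rfl

lemma aux_row {d : ℕ} (σ : ℝ) (x : Fin d → ℝ) (ν : ℝ) (hν : ν = σ ^ 2 * ∑ j, (x j) ^ 2) :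
    MeasurePreserving (fun w : Fin d → ℝ => ∑ j, w j * x j)
      (Measure.pi fun _ : Fin d => gaussianReal 0 (σ ^ 2).toNNReal)
      (gaussianReal 0 ν.toNNReal) := by
  refine ⟨by fun_prop, ?_⟩
  have hm : Measurable (fun w : Fin d → ℝ => ∑ j, w j * x j) := by fun_prop
  have : IsProbabilityMeasure ((Measure.pi fun _ : Fin d => gaussianReal 0 (σ ^ 2).toNNReal).map
    (fun w : Fin d → ℝ => ∑ j, w j * x j)) := Measure.isProbabilityMeasure_map hm.aemeasurable
  apply Measure.ext_of_charFun
  have hind : iIndepFun (fun (j : Fin d) (w : Fin d → ℝ) => w j * x j)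
      (Measure.pi fun _ : Fin d => gaussianReal 0 (σ ^ 2).toNNReal) :=
    iIndepFun_pi (X := fun j (t : ℝ) => t * x j) (fun j => by fun_prop)
  rw [hind.charFun_map_fun_sum_eq_prod (fun j => Measurable.aemeasurable (by fun_prop))]
  have hmap : ∀ j, (Measure.pi fun _ : Fin d => gaussianReal 0 (σ ^ 2).toNNReal).map
      (fun w : Fin d → ℝ => w j * x j) =
        (gaussianReal 0 (σ ^ 2).toNNReal).map (fun t => t * x j) := by
    intro j
    have e := (measurePreserving_eval
      (fun _ : Fin d => gaussianReal 0 (σ ^ 2).toNNReal) j).map_eq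
    conv_rhs => rw [← e]
    rw [Measure.map_map (by fun_prop) (by fun_prop)]
    rfl
  have hν0 : 0 ≤ ν := by rw [hν]; positivity
  ext t
  simp only [Finset.prod_apply, hmap, gaussianReal_map_mul_const, charFun_gaussianReal]
  rw [← Complex.exp_sum]
  congr 1
  rw [Real.coe_toNNReal _ hν0]
  simp only [NNReal.coe_mul, NNReal.coe_mk, Real.coe_toNNReal _ (sq_nonneg σ), hν]
  push_cast
  simp only [mul_zero, zero_mul, zero_sub, Finset.sum_neg_distrib, Finset.mul_sum,
    Finset.sum_mul, Finset.sum_div]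
  congr 1
  exact Finset.sum_congr rfl fun j _ => by ring

lemma aux_sq (v : ℝ) (hv : 0 ≤ v) : ∫ g, g ^ 2 ∂(gaussianReal 0 v.toNNReal) = v := by
  have h := variance_fun_id_gaussianReal (μ := 0) (v := v.toNNReal)
  rw [variance_of_integral_eq_zero (by fun_prop) (by simp)] at h
  rw [h, Real.coe_toNNReal _ hv]

lemma aux_mv {r d : ℕ} (σ : ℝ) (x : Fin d → ℝ) (ν : ℝ) (hν : ν = σ ^ 2 * ∑ j, (x j) ^ 2)
    (k : Fin r) :
    MeasurePreserving (fun w : Fin r → Fin d → ℝ => (Matrix.of w).mulVec x k)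
      (Measure.pi fun _ : Fin r => Measure.pi fun _ : Fin d => gaussianReal 0 (σ ^ 2).toNNReal)
      (gaussianReal 0 ν.toNNReal) :=
  (aux_row σ x ν hν).comp (measurePreserving_eval
    (fun _ : Fin r => Measure.pi fun _ : Fin d => gaussianReal 0 (σ ^ 2).toNNReal) k)

lemma aux_entry {m n : ℕ} (τ : ℝ) (p : Fin m × Fin n) :
    MeasurePreserving (fun w : Fin m → Fin n → ℝ => w p.1 p.2)
      (Measure.pi fun _ : Fin m => Measure.pi fun _ : Fin n => gaussianReal 0 (τ ^ 2).toNNReal)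
      (gaussianReal 0 (τ ^ 2).toNNReal) :=
  (measurePreserving_eval (fun _ : Fin n => gaussianReal 0 (τ ^ 2).toNNReal) p.2).comp
    (measurePreserving_eval
    (fun _ : Fin m => Measure.pi fun _ : Fin n => gaussianReal 0 (τ ^ 2).toNNReal) p.1)

lemma aux_int {Ω : Type*} [MeasurableSpace Ω] {μ : Measure Ω} {ρ : Measure ℝ} {X : Ω → ℝ}
    (hX : MeasurePreserving X μ ρ) {f : ℝ → ℝ} (hf : Measurable f) :
    ∫ ω, f (X ω) ∂μ = ∫ t, f t ∂ρ := by
  rw [← hX.map_eq, integral_map hX.measurable.aemeasurable hf.aestronglyMeasurable]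

lemma aux_cov {m n : ℕ} (τ : ℝ) (p q : Fin m × Fin n) :
    ∫ w : Fin m → Fin n → ℝ, w p.1 p.2 * w q.1 q.2
      ∂(Measure.pi fun _ : Fin m => Measure.pi fun _ : Fin n => gaussianReal 0 (τ ^ 2).toNNReal)
      = if p = q then τ ^ 2 else 0 := by
  have hz : ∀ p : Fin m × Fin n, ∫ w : Fin m → Fin n → ℝ, w p.1 p.2
      ∂(Measure.pi fun _ : Fin m => Measure.pi fun _ : Fin n => gaussianReal 0 (τ ^ 2).toNNReal)
      = 0 := fun p => by
    rw [aux_int (aux_entry τ p) (f := fun t => t) measurable_id]; simp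
  split_ifs with h
  · subst h
    have := aux_int (aux_entry τ p) (f := fun t => t ^ 2) (by fun_prop)
    rw [aux_sq _ (sq_nonneg τ)] at this
    simpa only [sq] using this
  · obtain ⟨a, k⟩ := p
    obtain ⟨b, l⟩ := q
    have hind : IndepFun (fun w : Fin m → Fin n → ℝ => w a k) (fun w => w b l)
        (Measure.pi fun _ : Fin m =>
          Measure.pi fun _ : Fin n => gaussianReal 0 (τ ^ 2).toNNReal) := by
      by_cases hab : a = b
      · subst hab
        have hkl : k ≠ l := fun e => h (by rw [e])
        have h0 : iIndepFun (fun (j : Fin n) (w : Fin n → ℝ) => w j)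
            (Measure.pi fun _ : Fin n => gaussianReal 0 (τ ^ 2).toNNReal) :=
          iIndepFun_pi (X := fun j (t : ℝ) => t) (fun j => by fun_prop)
        have h1 := h0.indepFun hkl
        rw [← (measurePreserving_eval (fun _ : Fin m =>
          Measure.pi fun _ : Fin n => gaussianReal 0 (τ ^ 2).toNNReal) a).map_eq] at h1
        rw [indepFun_iff_map_prod_eq_prod_map_map (Measurable.aemeasurable (by fun_prop))
          (Measurable.aemeasurable (by fun_prop))] at h1 ⊢
        rw [Measure.map_map (by fun_prop) (by fun_prop), Measure.map_map (by fun_prop) (by fun_prop),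
          Measure.map_map (by fun_prop) (by fun_prop)] at h1
        exact h1
      · have h0 : iIndepFun (fun (j : Fin m) (w : Fin m → Fin n → ℝ) => w j)
            (Measure.pi fun _ : Fin m =>
              Measure.pi fun _ : Fin n => gaussianReal 0 (τ ^ 2).toNNReal) :=
          iIndepFun_pi (X := fun j (t : Fin n → ℝ) => t) (fun j => by fun_prop)
        exact (h0.indepFun hab).comp (measurable_pi_apply k) (measurable_pi_apply l)
    have := hind.integral_mul_eq_mul_integral
      (Measurable.aestronglyMeasurable (by fun_prop)) (Measurable.aestronglyMeasurable (by fun_prop))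
    rw [hz (a, k)] at this
    simpa using this

/-- Gated-FFN expected projected output energy:
for `F_gate(x) = W̃_o [ψ(W_g x) ⊙ (W_u x)]` with independent i.i.d. centered Gaussian
weight matrices (`Var(W_g) = Var(W_u) = σ²`, `Var(W̃_o) = τ_g²`), an orthogonal
projector `P` of rank `r_P`, and `ν = σ²‖x‖₂²`,
`E‖P W̃_o (ψ(W_g x) ⊙ (W_u x))‖₂² = r_P τ_g² r ν E[ψ(G_ν)²]`. -/
theorem gated_ffn_projected_energy
    (r d dOut rP : ℕ) (σ τg : ℝ) (hσ : 0 < σ ^ 2) (hτg : 0 < τg ^ 2)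
    (P : Matrix (Fin dOut) (Fin dOut) ℝ)
    (hP1 : Pᵀ = P) (hP2 : P * P = P) (hrank : P.rank = rP)
    (x : Fin d → ℝ) (ν : ℝ) (hν : ν = σ ^ 2 * ∑ j, (x j) ^ 2)
    (ψ : ℝ → ℝ) (hψm : Measurable ψ)
    (hψ2 : Integrable (fun g => ψ g ^ 2) (gaussianReal 0 ν.toNNReal)) :
    ∫ ω : ((Fin r → Fin d → ℝ) × (Fin r → Fin d → ℝ)) × (Fin dOut → Fin r → ℝ),
        (∑ i, (P.mulVec ((Matrix.of ω.2).mulVec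
            (fun k => ψ ((Matrix.of ω.1.1).mulVec x k) *
              ((Matrix.of ω.1.2).mulVec x k))) i) ^ 2)
      ∂(((Measure.pi fun _ : Fin r =>
            Measure.pi fun _ : Fin d => gaussianReal 0 (σ ^ 2).toNNReal).prod
          (Measure.pi fun _ : Fin r =>
            Measure.pi fun _ : Fin d => gaussianReal 0 (σ ^ 2).toNNReal)).prod
          (Measure.pi fun _ : Fin dOut =>
            Measure.pi fun _ : Fin r => gaussianReal 0 (τg ^ 2).toNNReal))
      = (rP : ℝ) * τg ^ 2 * (r : ℝ) * ν *
          ∫ g, ψ g ^ 2 ∂(gaussianReal 0 ν.toNNReal) := by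
  have hν0 : 0 ≤ ν := by rw [hν]; positivity
  set μ : Measure (Fin r → Fin d → ℝ) := Measure.pi fun _ : Fin r =>
    Measure.pi fun _ : Fin d => gaussianReal 0 (σ ^ 2).toNNReal with hμ
  set κ : Measure (Fin dOut → Fin r → ℝ) := Measure.pi fun _ : Fin dOut =>
    Measure.pi fun _ : Fin r => gaussianReal 0 (τg ^ 2).toNNReal with hκ
  set I : ℝ := ∫ g, ψ g ^ 2 ∂(gaussianReal 0 ν.toNNReal) with hI
  let A : Fin r → (Fin r → Fin d → ℝ) → ℝ := fun k w => (Matrix.of w).mulVec x k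
  have hA : ∀ k, MeasurePreserving (A k) μ (gaussianReal 0 ν.toNNReal) := aux_mv σ x ν hν
  have hψL : MemLp ψ 2 (gaussianReal 0 ν.toNNReal) :=
    (memLp_two_iff_integrable_sq hψm.aestronglyMeasurable).2 hψ2
  have hψA : ∀ k, MemLp (fun w => ψ (A k w)) 2 μ := fun k => hψL.comp_measurePreserving (hA k)
  have hAL : ∀ k, MemLp (A k) 2 μ := fun k =>
    (memLp_id_gaussianReal' 2 (by simp)).comp_measurePreserving (hA k)
  have hW : ∀ p : Fin dOut × Fin r, MemLp (fun w : Fin dOut → Fin r → ℝ => w p.1 p.2) 2 κ :=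
    fun p => (memLp_id_gaussianReal' 2 (by simp)).comp_measurePreserving (aux_entry τg p)
  let H : Fin r → Fin r → ((Fin r → Fin d → ℝ) × (Fin r → Fin d → ℝ)) → ℝ :=
    fun k l z => (ψ (A k z.1) * ψ (A l z.1)) * (A k z.2 * A l z.2)
  have hHint : ∀ k l, Integrable (H k l) (μ.prod μ) := fun k l =>
    Integrable.mul_prod ((hψA k).integrable_mul (hψA l)) ((hAL k).integrable_mul (hAL l))
  have hHval : ∀ k, ∫ z, H k k z ∂(μ.prod μ) = I * ν := by
    intro k
    have e := integral_prod_mul (μ := μ) (ν := μ)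
      (fun w => ψ (A k w) * ψ (A k w)) (fun w => A k w * A k w)
    have e1 := aux_int (hA k) (f := fun t => ψ t * ψ t) (by fun_prop)
    have e2 := aux_int (hA k) (f := fun t => t * t) (by fun_prop)
    have e3 := aux_sq ν hν0
    simp only [sq] at e3
    refine e.trans ?_
    rw [e1, e2, e3, hI]
    simp only [sq]
  let T : Fin dOut → (Fin dOut × Fin r) → (Fin dOut × Fin r) →
      (((Fin r → Fin d → ℝ) × (Fin r → Fin d → ℝ)) × (Fin dOut → Fin r → ℝ)) → ℝ :=
    fun i p q ω => (P i p.1 * P i q.1) *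
      (H p.2 q.2 ω.1 * (ω.2 p.1 p.2 * ω.2 q.1 q.2))
  have hTint : ∀ i p q, Integrable (T i p q) ((μ.prod μ).prod κ) := fun i p q =>
    (Integrable.mul_prod (hHint p.2 q.2) ((hW p).integrable_mul (hW q))).const_mul _
  have hTval : ∀ i p q, ∫ ω, T i p q ω ∂((μ.prod μ).prod κ) =
      if p = q then P i p.1 * P i p.1 * (I * ν * τg ^ 2) else 0 := by
    intro i p q
    have e := integral_prod_mul (μ := μ.prod μ) (ν := κ)
      (H p.2 q.2) (fun w => w p.1 p.2 * w q.1 q.2)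
    rw [aux_cov τg p q] at e
    simp only [T]
    rw [integral_const_mul, e]
    split_ifs with h
    · subst h
      rw [hHval]
    · simp
  have hexp : ∀ ω : ((Fin r → Fin d → ℝ) × (Fin r → Fin d → ℝ)) × (Fin dOut → Fin r → ℝ),
      (∑ i, (P.mulVec ((Matrix.of ω.2).mulVec
            (fun k => ψ ((Matrix.of ω.1.1).mulVec x k) *
              ((Matrix.of ω.1.2).mulVec x k))) i) ^ 2) = ∑ i, ∑ p, ∑ q, T i p q ω := by
    intro ω
    refine Finset.sum_congr rfl fun i _ => ?_
    have e : P.mulVec ((Matrix.of ω.2).mulVec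
            (fun k => ψ ((Matrix.of ω.1.1).mulVec x k) *
              ((Matrix.of ω.1.2).mulVec x k))) i =
        ∑ p : Fin dOut × Fin r, P i p.1 * (ω.2 p.1 p.2 * (ψ (A p.2 ω.1.1) * A p.2 ω.1.2)) := by
      rw [Fintype.sum_prod_type]
      change ∑ a, P i a * (∑ k, ω.2 a k * (ψ (A k ω.1.1) * A k ω.1.2)) = _
      simp only [Finset.mul_sum]
    rw [e, sq, Finset.sum_mul_sum]
    refine Finset.sum_congr rfl fun p _ => Finset.sum_congr rfl fun q _ => ?_
    simp only [T, H]
    ring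
  simp only [hexp]
  rw [integral_finsetSum _ fun i _ => integrable_finsetSum _ fun p _ =>
    integrable_finsetSum _ fun q _ => hTint i p q]
  have h1 : ∀ i, ∫ ω, ∑ p, ∑ q, T i p q ω ∂((μ.prod μ).prod κ) =
      ∑ p : Fin dOut × Fin r, P i p.1 * P i p.1 * (I * ν * τg ^ 2) := by
    intro i
    rw [integral_finsetSum _ fun p _ => integrable_finsetSum _ fun q _ => hTint i p q]
    refine Finset.sum_congr rfl fun p _ => ?_
    rw [integral_finsetSum _ fun q _ => hTint i p q]
    simp [hTval]
  simp only [h1]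
  have htr : ∑ i, ∑ a, P i a * P i a = (rP : ℝ) := by
    rw [← hrank, ← aux_trace P hP2]
    conv_rhs => rw [← hP2]
    simp only [Matrix.trace, Matrix.diag, Matrix.mul_apply]
    refine Finset.sum_congr rfl fun i _ => Finset.sum_congr rfl fun a _ => ?_
    have : P a i = P i a := by
      conv_lhs => rw [← hP1]
      rfl
    rw [this]
  simp only [Fintype.sum_prod_type, Finset.sum_const, Finset.card_univ, Fintype.card_fin,
    nsmul_eq_mul, ← Finset.mul_sum, ← Finset.sum_mul, htr]
  ring
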